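/- arXiv:1912.12648 — 2 statements merged into one kernel-verified Lean document; each statement's English description precedes it below -/
import Mathlib

section
/- Suppose p = 2. Let a ∈ GF(Q) be nonzero. Then P_a(X) = X^{q+1} + X + a has exactly one zero in GF(Q) if and only if F(a) ≠ 0 and G(a) = 0; and in this case the unique zero of P_a in GF(Q) is the (unique) square root of a·F(a)^{q-1} in GF(Q). -/
open Polynomial

noncomputable abbrev Kbar (p : ℕ) [Fact p.Prime] : Type := AlgebraicClosure (ZMod p)

noncomputable def A (q : ℕ) (K : Type) [Field K] : ℕ → Polynomial K
  | 0 => 0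
  | 1 => 1
  | 2 => -1
  | (r+3) => -(A q K (r+2))^q - X^q * (A q K (r+1))^(q^2)

theorem eval_A_zero {K : Type} [Field K] {q : ℕ} {a : K} : (A q K 0).eval a = 0 := by simp [A]

theorem eval_A_one {K : Type} [Field K] {q : ℕ} {a : K} : (A q K 1).eval a = 1 := by simp [A]

section Recurrence

variable {K : Type} [Field K] [CharP K 2] {k q : ℕ} {a : K}

theorem add_pow_two_pow (hq : q = 2 ^ k) (x y : K) : (x + y) ^ q = x ^ q + y ^ q := by
  subst hq
  exact add_pow_char_pow x y 2 k

theorem eval_A_add_two (hq : q = 2 ^ k) (r : ℕ) :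
    (A q K (r + 2)).eval a
      = ((A q K (r + 1)).eval a) ^ q + a ^ q * (((A q K r).eval a) ^ q) ^ q := by
  have hq0 : q ≠ 0 := by rw [hq]; positivity
  cases r with
  | zero => simp [A, hq0, CharTwo.neg_eq]
  | succ r => simp [A, CharTwo.neg_eq, CharTwo.sub_eq_add, sq, pow_mul]

theorem eval_A_add_two' (hq : q = 2 ^ k) (r : ℕ) :
    (A q K (r + 2)).eval a = (A q K (r + 1)).eval a + a ^ q ^ r * (A q K r).eval a := by
  have hq0 : q ≠ 0 := by rw [hq]; positivity
  induction r using Nat.twoStepInduction with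
  | zero => simp [eval_A_add_two hq, eval_A_zero, eval_A_one, hq0]
  | one => simp [eval_A_add_two hq, eval_A_zero, eval_A_one, hq0]
  | more r h0 h1 =>
    have e1 := eval_A_add_two (K := K) (a := a) hq r
    have e2 := eval_A_add_two (K := K) (a := a) hq (r + 1)
    have e3 := eval_A_add_two (K := K) (a := a) hq (r + 2)
    have h0' := congrArg (fun t => (t ^ q) ^ q) h0
    have h1' := congrArg (fun t => t ^ q) h1
    simp only [add_pow_two_pow hq, mul_pow, ← pow_mul a, ← pow_succ] at h0' h1'
    rw [e3, h1', h0', e2, e1, add_pow_two_pow hq]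
    ring

theorem eval_A_pow_eq_self {Q : ℕ} (hq : q = 2 ^ k) {n : ℕ} (hQ : Q = 2 ^ n) (ha : a ^ Q = a)
    (r : ℕ) : ((A q K r).eval a) ^ Q = (A q K r).eval a := by
  induction r using Nat.twoStepInduction with
  | zero => simp [eval_A_zero, hQ]
  | one => simp [eval_A_one]
  | more r h0 h1 =>
    rw [eval_A_add_two hq, add_pow_two_pow hQ, mul_pow, pow_right_comm a, ha,
      pow_right_comm _ q Q, h1, pow_right_comm _ q Q, pow_right_comm _ q Q, h0]

theorem eval_A_mul_eval_A_add (hq : q = 2 ^ k) (r : ℕ) :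
    (A q K (r + 2)).eval a * ((A q K r).eval a) ^ q + ((A q K (r + 1)).eval a) ^ (q + 1)
      = a ^ (q * ∑ i ∈ Finset.range r, q ^ i) := by
  have hq0 : q ≠ 0 := by rw [hq]; positivity
  induction r with
  | zero => simp [eval_A_zero, eval_A_one, hq0]
  | succ r ih =>
    have e1 := eval_A_add_two (K := K) (a := a) hq r
    have e2 := eval_A_add_two (K := K) (a := a) hq (r + 1)
    have ih' := congrArg (fun t => t ^ q * a ^ q) ih
    simp only [add_pow_two_pow hq, mul_pow, ← pow_mul a] at ih'
    rw [geom_sum_succ, show q * (q * ∑ i ∈ Finset.range r, q ^ i + 1)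
      = q * (∑ i ∈ Finset.range r, q ^ i) * q + q by ring, pow_add a, ← ih', e2]
    have h2 : (2 : K) = 0 := CharTwo.two_eq_zero
    simp only [pow_succ _ q, mul_pow]
    linear_combination ((A q K (r + 2)).eval a) ^ q * e1 +
      ((A q K (r + 2)).eval a) ^ q * ((A q K (r + 1)).eval a) ^ q * h2

variable {x : K}

theorem eval_A_mul_root_add (hq : q = 2 ^ k) (hx : x ^ (q + 1) + x + a = 0) (r : ℕ) :
    (A q K (r + 1)).eval a * x + a * ((A q K r).eval a) ^ q
      = x ^ ∑ i ∈ Finset.range (r + 1), q ^ i := by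
  have hq0 : q ≠ 0 := by rw [hq]; positivity
  induction r with
  | zero => simp [eval_A_zero, eval_A_one, hq0]
  | succ r ih =>
    rw [geom_sum_succ, pow_succ, mul_comm q, pow_mul, ← ih, eval_A_add_two hq,
      add_pow_two_pow hq, mul_pow, mul_pow]
    have h2 : (2 : K) = 0 := CharTwo.two_eq_zero
    linear_combination (-((A q K (r + 1)).eval a) ^ q) * hx +
      ((A q K (r + 1)).eval a) ^ q * (a + x) * h2

theorem root_quadratic (hq : q = 2 ^ k) {m : ℕ} (hx : x ^ (q + 1) + x + a = 0)
    (hxm : x ^ q ^ (m + 1) = x) :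
    (A q K (m + 1)).eval a * x ^ 2
      + ((A q K (m + 2)).eval a + a * ((A q K m).eval a) ^ q) * x
      + a * ((A q K (m + 1)).eval a) ^ q = 0 := by
  have h0 := eval_A_mul_root_add hq hx m
  have h1 := eval_A_mul_root_add hq hx (m + 1)
  rw [geom_sum_succ', pow_add, hxm, ← h0] at h1
  have h2 : (2 : K) = 0 := CharTwo.two_eq_zero
  linear_combination h1 + ((A q K (m + 1)).eval a * x ^ 2 + a * ((A q K m).eval a) ^ q * x) * h2

theorem eval_A_pow_of_pow_eq (hq : q = 2 ^ k) {m : ℕ} (ham : a ^ q ^ (m + 1) = a) :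
    ((A q K (m + 2)).eval a) ^ q
      = ((A q K (m + 1)).eval a) ^ q + a * ((A q K m).eval a) ^ q := by
  rw [eval_A_add_two' hq m, add_pow_two_pow hq, mul_pow, ← pow_mul, ← pow_succ, ham]

theorem trace_pow_eq_self (hq : q = 2 ^ k) {m : ℕ} (ham : a ^ q ^ (m + 1) = a) :
    ((A q K (m + 2)).eval a + a * ((A q K m).eval a) ^ q) ^ q
      = (A q K (m + 2)).eval a + a * ((A q K m).eval a) ^ q := by
  rw [add_pow_two_pow hq, mul_pow, eval_A_pow_of_pow_eq hq ham]
  have h2 : (2 : K) = 0 := CharTwo.two_eq_zero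
  linear_combination -eval_A_add_two (K := K) (a := a) hq m

theorem trace_eq_linearized (hq : q = 2 ^ k) {m : ℕ} (ham : a ^ q ^ (m + 1) = a) :
    (A q K (m + 2)).eval a + a * ((A q K m).eval a) ^ q
      = a ^ q * (((A q K (m + 1)).eval a) ^ q) ^ q + ((A q K (m + 1)).eval a) ^ q
        + a * (A q K (m + 1)).eval a := by
  have e1 := eval_A_add_two (K := K) (a := a) hq (m + 1)
  have e2 := eval_A_add_two' (K := K) (a := a) hq (m + 1)
  have e3 := eval_A_pow_of_pow_eq (K := K) hq ham
  rw [ham] at e2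
  have h2 : (2 : K) = 0 := CharTwo.two_eq_zero
  linear_combination e1 - e2 + e3 +
    (a * ((A q K m).eval a) ^ q - a * (A q K (m + 1)).eval a) * h2

theorem root_of_sq_eq (hq : q = 2 ^ k) {m : ℕ} (ham : a ^ q ^ (m + 1) = a)
    (hF : (A q K (m + 1)).eval a ≠ 0)
    (hG : (A q K (m + 2)).eval a + a * ((A q K m).eval a) ^ q = 0)
    {y : K} (hy : y ^ 2 = a * ((A q K (m + 1)).eval a) ^ (q - 1)) :
    y ^ (q + 1) + y + a = 0 := by
  obtain ⟨t, rfl⟩ : ∃ t, q = t + 1 := ⟨q - 1, by have : 0 < q := by rw [hq]; positivity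
                                                 omega⟩
  rw [trace_eq_linearized hq ham] at hG
  simp only [Nat.add_sub_cancel] at hy
  set F := (A (t + 1) K (m + 1)).eval a
  have hyF : y ^ 2 * F = a * F ^ (t + 1) := by rw [hy]; ring
  have hyq := congrArg (fun z => z ^ (t + 1)) hyF
  simp only [mul_pow] at hyq
  have h2 : (2 : K) = 0 := CharTwo.two_eq_zero
  have key : F ^ (t + 1) * F * (y ^ (t + 1 + 1) + y + a) ^ 2 = 0 := by
    linear_combination (F ^ (t + 1) + (y ^ 2) ^ (t + 1) * F ^ (t + 1)) * hyF
      + a * F ^ (t + 1) * hyq + a * F ^ (t + 1) * hG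
      + F ^ (t + 1) * F * (y ^ (t + 1 + 1) * y + y ^ (t + 1 + 1) * a + y * a) * h2
  simpa [hF] using key

theorem conjugate_root (hq : q = 2 ^ k) {F G : K} (hF : F ≠ 0) (hG : G ^ q = G) (ha : a ≠ 0)
    (hx : x ^ (q + 1) + x + a = 0) (hquad : F * x ^ 2 + G * x + a * F ^ q = 0) :
    (x + G / F) ^ (q + 1) + (x + G / F) + a = 0 := by
  have hx0 : x ≠ 0 := by rintro rfl; simp_all
  have h2 : (2 : K) = 0 := CharTwo.two_eq_zero
  rw [pow_succ, add_pow_two_pow hq, div_pow, hG]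
  have hxq : x ^ q = (x + a) / x := by
    rw [eq_div_iff hx0, ← pow_succ]
    linear_combination hx - (x + a) * h2
  have hFq : F ^ q ≠ 0 := pow_ne_zero _ hF
  have hx' : (x + G / F) = a * F ^ q / (F * x) := by
    field_simp
    linear_combination hquad - a * F ^ q * h2
  rw [hx', hxq]
  field_simp
  linear_combination a * hquad + a * x * F ^ q * h2

theorem sum_eval_A_telescope (hq : q = 2 ^ k) (t : ℕ → K) (m : ℕ) :
    ∑ i ∈ Finset.range m, ((A q K (i + 1)).eval a * t i + ((A q K (i + 1)).eval a) ^ q * t (i + 1)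
        + a ^ q * (((A q K (i + 1)).eval a) ^ q) ^ q * t (i + 2))
      = t 0 + (A q K (m + 1)).eval a * t m + a ^ q * (((A q K m).eval a) ^ q) ^ q * t (m + 1) := by
  have hq0 : q ≠ 0 := by rw [hq]; positivity
  have h2 : (2 : K) = 0 := CharTwo.two_eq_zero
  induction m with
  | zero =>
    simp [eval_A_zero, eval_A_one, hq0]
    linear_combination -t 0 * h2
  | succ m ih =>
    rw [Finset.sum_range_succ, ih, eval_A_add_two hq m]
    linear_combination (A q K (m + 1)).eval a * t m * h2

/-- A twisted trace that solves `(x + a) s ^ q ^ 2 + x s ^ q + a s = 0` when `x` is a root of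
`X ^ (q + 1) + X + a` and `A_m` vanishes at `a`. -/
noncomputable def twistedTrace (q : ℕ) (a x : K) (m : ℕ) (α : K) : K :=
  ∑ i ∈ Finset.range m,
    (x / a) ^ (∑ j ∈ Finset.range i, q ^ j) * (A q K (i + 1)).eval a * α ^ q ^ i

theorem sum_pow_two_pow (hq : q = 2 ^ k) (s : Finset ℕ) (f : ℕ → K) :
    (∑ i ∈ s, f i) ^ q = ∑ i ∈ s, f i ^ q := by
  subst hq
  exact sum_pow_char_pow 2 k s f

theorem twistedTrace_equation (hq : q = 2 ^ k) {m : ℕ} (ha : a ≠ 0)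
    (hx : x ^ (q + 1) + x + a = 0) (hxm : x ^ q ^ (m + 1) = x)
    (hF : (A q K (m + 1)).eval a = 0) {α : K} (hα : α ^ q ^ (m + 1) = α) :
    x ^ (q + 1) * ((twistedTrace q a x (m + 1) α) ^ q) ^ q
      + x * (twistedTrace q a x (m + 1) α) ^ q + a * twistedTrace q a x (m + 1) α = 0 := by
  have hq0 : q ≠ 0 := by rw [hq]; positivity
  have hx0 : x ≠ 0 := by rintro rfl; simp_all
  have h2 : (2 : K) = 0 := CharTwo.two_eq_zero
  have hb : ∀ i, x * ((x / a) ^ (∑ j ∈ Finset.range i, q ^ j)) ^ q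
      = a * (x / a) ^ (∑ j ∈ Finset.range (i + 1), q ^ j) := fun i => by
    rw [geom_sum_succ, pow_succ, mul_comm q, pow_mul]
    field_simp
  have htel := sum_eval_A_telescope (K := K) (a := a) hq
    (fun i => (x / a) ^ (∑ j ∈ Finset.range i, q ^ j) * α ^ q ^ i) (m + 1)
  have hlam : (A q K (m + 2)).eval a = x ^ (∑ j ∈ Finset.range (m + 1), q ^ j) := by
    have := eval_A_mul_root_add hq hx (m + 1)
    rw [hF, zero_pow hq0, mul_zero, add_zero, geom_sum_succ', pow_add, hxm, mul_comm x] at this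
    exact mul_right_cancel₀ hx0 this
  have htr : (A q K (m + 2)).eval a + a * ((A q K m).eval a) ^ q = 0 := by
    have := root_quadratic hq hx hxm
    simpa [hF, hq0, hx0] using this
  have hdet : (A q K (m + 2)).eval a * (A q K (m + 2)).eval a
      = a ^ (∑ j ∈ Finset.range (m + 1), q ^ j) := by
    have := eval_A_mul_eval_A_add (K := K) (a := a) hq m
    rw [hF, zero_pow (by omega), add_zero] at this
    rw [geom_sum_succ, pow_succ, ← this]
    linear_combination (A q K (m + 2)).eval a * htr
      - a * (A q K (m + 2)).eval a * ((A q K m).eval a) ^ q * h2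
  have hsum : x ^ (q + 1) * ((twistedTrace q a x (m + 1) α) ^ q) ^ q
      + x * (twistedTrace q a x (m + 1) α) ^ q + a * twistedTrace q a x (m + 1) α
      = a * (∑ i ∈ Finset.range (m + 1), ((A q K (i + 1)).eval a *
            ((x / a) ^ (∑ j ∈ Finset.range i, q ^ j) * α ^ q ^ i)
          + ((A q K (i + 1)).eval a) ^ q *
            ((x / a) ^ (∑ j ∈ Finset.range (i + 1), q ^ j) * α ^ q ^ (i + 1))
          + a ^ q * (((A q K (i + 1)).eval a) ^ q) ^ q *
            ((x / a) ^ (∑ j ∈ Finset.range (i + 2), q ^ j) * α ^ q ^ (i + 2)))) := by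
    rw [twistedTrace, sum_pow_two_pow hq, sum_pow_two_pow hq, Finset.mul_sum, Finset.mul_sum,
      Finset.mul_sum, Finset.mul_sum, ← Finset.sum_add_distrib, ← Finset.sum_add_distrib]
    refine Finset.sum_congr rfl fun i _ => ?_
    have h1 := hb i
    have h1' := congrArg (fun z => z ^ q) h1
    have h3 := hb (i + 1)
    simp only [mul_pow] at h1'
    simp only [mul_pow, ← pow_mul α, ← pow_succ q]
    linear_combination ((A q K (i + 1)).eval a) ^ q * α ^ q ^ (i + 1) * h1
      + x * (((A q K (i + 1)).eval a) ^ q) ^ q * α ^ q ^ (i + 2) * h1'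
      + a ^ q * (((A q K (i + 1)).eval a) ^ q) ^ q * α ^ q ^ (i + 2) * h3
  rw [hsum, htel, hF, hα, div_pow x a (∑ j ∈ Finset.range (m + 1), q ^ j), ← hdet, ← hlam]
  have hlam0 : (A q K (m + 2)).eval a ≠ 0 := by rw [hlam]; exact pow_ne_zero _ hx0
  field_simp
  simp [hq0, CharTwo.add_self_eq_zero]

theorem twistedTrace_pow_add (hq : q = 2 ^ k) {m : ℕ} (hF : (A q K (m + 1)).eval a = 0) (α : K) :
    (twistedTrace q a x (m + 1) α) ^ q + twistedTrace q a x (m + 1) α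
      = ∑ i ∈ Finset.range (m + 1),
        ((x / a) ^ (∑ j ∈ Finset.range i, q ^ j) * (A q K (i + 1)).eval a
          + ((x / a) ^ (∑ j ∈ Finset.range (i - 1), q ^ j)) ^ q * ((A q K i).eval a) ^ q)
        * α ^ q ^ i := by
  have hq0 : q ≠ 0 := by rw [hq]; positivity
  simp only [add_mul, Finset.sum_add_distrib]
  rw [add_comm, twistedTrace, sum_pow_two_pow hq]
  congr 1
  rw [Finset.sum_range_succ, Finset.sum_range_succ']
  simp only [hF, eval_A_zero, zero_pow hq0, mul_zero, zero_mul, add_zero, Nat.add_sub_cancel,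
    mul_pow, ← pow_mul α, ← pow_succ q]

theorem twistedTrace_pow_eq_self (hq : q = 2 ^ k) {n Q : ℕ} (hQ : Q = 2 ^ n) (ha : a ^ Q = a)
    (hx : x ^ Q = x) (m : ℕ) {α : K} (hα : α ^ Q = α) :
    (twistedTrace q a x m α) ^ Q = twistedTrace q a x m α := by
  rw [twistedTrace, sum_pow_two_pow hQ]
  refine Finset.sum_congr rfl fun i _ => ?_
  rw [mul_pow, mul_pow, eval_A_pow_eq_self hq hQ ha, pow_right_comm, pow_right_comm α, hα,
    div_pow, hx, ha]

end Recurrence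

section FiniteField

theorem pow_two_pow_of_dvd {K : Type} [Monoid K] {x : K} {n N : ℕ} (hx : x ^ 2 ^ n = x)
    (h : n ∣ N) : x ^ 2 ^ N = x := by
  obtain ⟨t, rfl⟩ := h
  induction t with
  | zero => simp
  | succ t ih => rw [mul_add, pow_add, pow_mul, ih, mul_one, hx]

theorem pow_two_pow_mod {K : Type} [Monoid K] {x : K} {n : ℕ} (hx : x ^ 2 ^ n = x) (N : ℕ) :
    x ^ 2 ^ (N % n) = x ^ 2 ^ N := by
  conv_rhs => rw [← Nat.div_add_mod N n, pow_add, pow_mul, pow_two_pow_of_dvd hx ⟨_, rfl⟩]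

theorem dvd_mul_div_gcd (n k : ℕ) : n ∣ k * (n / n.gcd k) := by
  rw [← Nat.mul_div_assoc _ (Nat.gcd_dvd_left n k), mul_comm,
    Nat.mul_div_assoc _ (Nat.gcd_dvd_right n k)]
  exact dvd_mul_right _ _

theorem div_gcd_dvd_of_dvd_mul {n k i : ℕ} (hn : 0 < n) (h : n ∣ k * i) : n / n.gcd k ∣ i := by
  have hd : 0 < n.gcd k := Nat.gcd_pos_of_pos_left _ hn
  refine (Nat.coprime_div_gcd_div_gcd hd).dvd_of_dvd_mul_left ?_
  refine Nat.dvd_of_mul_dvd_mul_left hd ?_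
  rwa [Nat.mul_div_cancel' (Nat.gcd_dvd_left n k), ← mul_assoc,
    Nat.mul_div_cancel' (Nat.gcd_dvd_right n k)]

theorem card_roots_X_pow_sub_X {K : Type} [Field K] [CharP K 2] [IsAlgClosed K] [DecidableEq K]
    {n : ℕ} (hn : 0 < n) : ((X ^ 2 ^ n - X : K[X]).roots.toFinset).card = 2 ^ n := by
  have hsep : (X ^ 2 ^ n - X : K[X]).Separable :=
    galois_poly_separable 2 _ (dvd_pow_self 2 hn.ne')
  rw [Multiset.toFinset_card_of_nodup (nodup_roots hsep),
    IsAlgClosed.card_roots_eq_natDegree]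
  exact FiniteField.X_pow_card_sub_X_natDegree_eq K (Nat.one_lt_two_pow hn.ne')

/-- Independence of the powers of the Frobenius `x ↦ x ^ q` on the field with `2 ^ n` elements. -/
theorem exists_sum_mul_pow_ne_zero {K : Type} [Field K] [CharP K 2] [IsAlgClosed K]
    {k n q m : ℕ} (hq : q = 2 ^ k) (hn : 0 < n) (hm : m + 1 = n / n.gcd k)
    (c : ℕ → K) (hc : c 0 ≠ 0) :
    ∃ α : K, α ^ 2 ^ n = α ∧ ∑ i ∈ Finset.range (m + 1), c i * α ^ q ^ i ≠ 0 := by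
  classical
  by_contra! hcon
  set p : K[X] := ∑ i ∈ Finset.range (m + 1), C (c i) * X ^ 2 ^ (k * i % n) with hp
  have hdeg : p.natDegree < 2 ^ n := by
    refine lt_of_le_of_lt (natDegree_sum_le_of_forall_le (n := 2 ^ (n - 1)) _ _ fun i _ => ?_)
      (Nat.pow_lt_pow_right one_lt_two (by omega))
    refine (natDegree_C_mul_X_pow_le _ _).trans (Nat.pow_le_pow_right two_pos ?_)
    have := Nat.mod_lt (k * i) hn
    omega
  have hzero : p = 0 := by
    refine eq_zero_of_natDegree_lt_card_of_eval_eq_zero' p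
      (X ^ 2 ^ n - X : K[X]).roots.toFinset (fun α hα => ?_) ?_
    · have hα' : α ^ 2 ^ n = α := by
        rw [Multiset.mem_toFinset] at hα
        simpa [sub_eq_zero] using (isRoot_of_mem_roots hα)
      rw [← hcon α hα', hp, eval_finsetSum]
      refine Finset.sum_congr rfl fun i _ => ?_
      rw [eval_C_mul, eval_pow, eval_X, pow_two_pow_mod hα', hq, pow_mul]
    · rwa [card_roots_X_pow_sub_X hn]
  apply hc
  have hcoeff : p.coeff 1 = c 0 := by
    rw [hp, finsetSum_coeff, Finset.sum_eq_single 0]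
    · simp
    · intro i hi hi0
      rw [coeff_C_mul, coeff_X_pow, if_neg, mul_zero]
      intro h
      have hmod : k * i % n = 0 := by
        by_contra hne
        exact (Nat.one_lt_two_pow hne).ne h
      have := Nat.le_of_dvd (by omega) (div_gcd_dvd_of_dvd_mul hn (Nat.dvd_of_mod_eq_zero hmod))
      rw [Finset.mem_range] at hi
      omega
    · simp
  rw [← hcoeff, hzero, coeff_zero]

end FiniteField

/-- If `A_m` vanishes at `a`, a root of `X ^ (q + 1) + X + a` is never unique. -/
theorem exists_other_root {K : Type} [Field K] [CharP K 2] [IsAlgClosed K]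
    {k n q Q m : ℕ} (hq : q = 2 ^ k) (hQ : Q = 2 ^ n) (hn : 0 < n) (hm : m + 1 = n / n.gcd k)
    {a x : K} (haQ : a ^ Q = a) (ha : a ≠ 0) (hxQ : x ^ Q = x)
    (hx : x ^ (q + 1) + x + a = 0) (hF : (A q K (m + 1)).eval a = 0) :
    ∃ y : K, y ^ Q = y ∧ y ^ (q + 1) + y + a = 0 ∧ y ≠ x := by
  have hq0 : q ≠ 0 := by rw [hq]; positivity
  have hx0 : x ≠ 0 := by rintro rfl; simp_all
  have hfix : ∀ z : K, z ^ Q = z → z ^ q ^ (m + 1) = z := fun z hz => by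
    rw [hq, ← pow_mul, hm]
    exact pow_two_pow_of_dvd (hQ ▸ hz) (dvd_mul_div_gcd n k)
  obtain ⟨α, hα, hne⟩ := exists_sum_mul_pow_ne_zero (K := K) hq hn hm
    (fun i => (x / a) ^ (∑ j ∈ Finset.range i, q ^ j) * (A q K (i + 1)).eval a
          + ((x / a) ^ (∑ j ∈ Finset.range (i - 1), q ^ j)) ^ q * ((A q K i).eval a) ^ q)
    (by simp [eval_A_zero, eval_A_one, hq0])
  rw [← hQ] at hα
  rw [← twistedTrace_pow_add hq hF] at hne
  have heq := twistedTrace_equation hq ha hx (hfix x hxQ) hF (hfix α hα)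
  have hsQ := twistedTrace_pow_eq_self hq hQ haQ hxQ (m + 1) hα
  set s := twistedTrace q a x (m + 1) α
  have hs0 : s ≠ 0 := by
    intro h
    simp [h, hq0] at hne
  have hsq0 : s ^ q ≠ 0 := pow_ne_zero _ hs0
  refine ⟨x * s ^ q / s, ?_, ?_, ?_⟩
  · rw [div_pow, mul_pow, pow_right_comm, hsQ, hxQ]
  · rw [pow_succ, div_pow, mul_pow]
    field_simp
    linear_combination heq
  · intro h
    rw [div_eq_iff hs0] at h
    rw [mul_left_cancel₀ hx0 h, CharTwo.add_self_eq_zero] at hne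
    exact hne rfl

/-- `p = 2`. For nonzero `a ∈ GF(Q)`: `P_a(X) = X^{q+1} + X + a` has exactly one zero in
`GF(Q)` iff `F(a) ≠ 0` and `G(a) = 0`; and in this case the unique zero is the (unique)
square root of `a·F(a)^{q-1}`.  Here `F(a) = A_m(a)`,
`G(a) = -A_{m+1}(a) - a·A_{m-1}(a)^q`, `q = 2^k`, `Q = 2^n`, `d = gcd(n,k)`, `m = n/d`. -/
theorem statement_18 (k n d m q Q : ℕ) (hk : 0 < k) (hn : 0 < n)
    (hd : d = Nat.gcd n k) (hm : m = n / d) (hq : q = 2 ^ k) (hQ : Q = 2 ^ n)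
    (a : Kbar 2) (haQ : a ^ Q = a) (ha0 : a ≠ 0)
    (Fa Ga : Kbar 2)
    (hFa : Fa = (A q (Kbar 2) m).eval a)
    (hGa : Ga = -(A q (Kbar 2) (m + 1)).eval a - a * ((A q (Kbar 2) (m - 1)).eval a) ^ q) :
    ({x : Kbar 2 | x ^ Q = x ∧ x ^ (q + 1) + x + a = 0}.ncard = 1 ↔ Fa ≠ 0 ∧ Ga = 0) ∧
    (Fa ≠ 0 → Ga = 0 → ∀ y : Kbar 2, y ^ 2 = a * Fa ^ (q - 1) →
      {x : Kbar 2 | x ^ Q = x ∧ x ^ (q + 1) + x + a = 0} = {y}) := by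
  have hq0 : q ≠ 0 := by rw [hq]; positivity
  obtain ⟨M, rfl⟩ : ∃ M, m = M + 1 := Nat.exists_eq_succ_of_ne_zero (by
    rw [hm, hd]
    exact (Nat.div_pos (Nat.gcd_le_left _ hn) (Nat.gcd_pos_of_pos_left _ hn)).ne')
  rw [hd] at hm
  rw [Nat.add_sub_cancel, CharTwo.neg_eq, CharTwo.sub_eq_add] at hGa
  have hfix : ∀ z : Kbar 2, z ^ Q = z → z ^ q ^ (M + 1) = z := fun z hz => by
    rw [hq, ← pow_mul, hm]
    exact pow_two_pow_of_dvd (hQ ▸ hz) (dvd_mul_div_gcd n k)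
  have hquad : ∀ x : Kbar 2, x ^ Q = x → x ^ (q + 1) + x + a = 0 →
      Fa * x ^ 2 + Ga * x + a * Fa ^ q = 0 := fun x hxQ hx => by
    rw [hFa, hGa]
    exact root_quadratic hq hx (hfix x hxQ)
  have hFQ : Fa ^ Q = Fa := hFa ▸ eval_A_pow_eq_self hq hQ haQ _
  have hGQ : Ga ^ Q = Ga := by
    rw [hGa, add_pow_two_pow hQ, mul_pow, pow_right_comm, haQ, eval_A_pow_eq_self hq hQ haQ,
      eval_A_pow_eq_self hq hQ haQ]
  have huniq : Fa ≠ 0 → Ga = 0 → ∀ y : Kbar 2, y ^ 2 = a * Fa ^ (q - 1) →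
      {x : Kbar 2 | x ^ Q = x ∧ x ^ (q + 1) + x + a = 0} = {y} := by
    intro hF0 hG0 y hy
    ext x
    simp only [Set.mem_ofPred_eq, Set.mem_singleton_iff]
    constructor
    · rintro ⟨hxQ, hx⟩
      have hxF := hquad x hxQ hx
      rw [hG0, zero_mul, add_zero, ← Nat.sub_add_cancel (Nat.one_le_iff_ne_zero.2 hq0), pow_succ Fa,
        CharTwo.add_eq_zero] at hxF
      refine CharTwo.sq_injective (mul_left_cancel₀ hF0 ?_)
      change Fa * x ^ 2 = Fa * y ^ 2
      rw [hxF, hy]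
      ring
    · rintro rfl
      refine ⟨CharTwo.sq_injective ?_, ?_⟩
      · change (x ^ Q) ^ 2 = x ^ 2
        rw [pow_right_comm, hy, mul_pow, pow_right_comm, haQ, hFQ]
      · exact root_of_sq_eq hq (hfix a haQ) (hFa ▸ hF0) (hGa ▸ hG0) (hFa ▸ hy)
  refine ⟨⟨fun hcard => ?_, fun ⟨hF0, hG0⟩ => ?_⟩, huniq⟩
  · obtain ⟨x, hS⟩ := Set.ncard_eq_one.1 hcard
    obtain ⟨hxQ, hx⟩ : x ^ Q = x ∧ x ^ (q + 1) + x + a = 0 := hS.symm.subset rfl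
    have hall : ∀ y : Kbar 2, y ^ Q = y → y ^ (q + 1) + y + a = 0 → y = x :=
      fun y h1 h2 => hS.subset ⟨h1, h2⟩
    have hF0 : Fa ≠ 0 := fun hF => by
      obtain ⟨y, h1, h2, hne⟩ := exists_other_root hq hQ hn hm haQ ha0 hxQ hx (hFa ▸ hF)
      exact hne (hall y h1 h2)
    refine ⟨hF0, ?_⟩
    have hGq : Ga ^ q = Ga := hGa ▸ trace_pow_eq_self hq (hfix a haQ)
    have h := hall _ (by rw [add_pow_two_pow hQ, div_pow, hxQ, hGQ, hFQ])
      (conjugate_root hq hF0 hGq ha0 hx (hquad x hxQ hx))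
    simpa [hF0] using h
  · obtain ⟨y, hy⟩ := IsAlgClosed.exists_pow_nat_eq (a * Fa ^ (q - 1)) two_pos
    rw [huniq hF0 hG0 y hy, Set.ncard_singleton]
end

section
/- Suppose p = 2. Let a ∈ GF(Q) be nonzero and set H = Tr_{GF(2^d)/GF(2)}( N_{GF(Q)/GF(2^d)}(a) / G(a)^2 ) when G(a) ≠ 0. Then P_a(X) = X^{q+1} + X + a has no zeros in GF(Q) if and only if G(a) ≠ 0 and H ≠ 0. -/
open Polynomial

section TwistedProduct

variable {K : Type*} [Field K]

/-- The twisted product `σ^(r-1)(M) ⋯ σ(M) M`. -/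
def twistedProd (σ : K →+* K) (M : Matrix (Fin 2) (Fin 2) K) : ℕ → Matrix (Fin 2) (Fin 2) K
  | 0 => 1
  | r + 1 => (twistedProd σ M r).map σ * M

theorem twistedProd_succ' (σ : K →+* K) (M : Matrix (Fin 2) (Fin 2) K) (r : ℕ) :
    twistedProd σ M (r + 1) = M.map (σ^[r]) * twistedProd σ M r := by
  induction r with
  | zero => simp [twistedProd]
  | succ r ih =>
    conv_lhs => rw [twistedProd, ih, Matrix.map_mul, Matrix.mul_assoc]
    rw [Matrix.map_map, ← Function.iterate_succ', twistedProd]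

theorem det_twistedProd (σ : K →+* K) (M : Matrix (Fin 2) (Fin 2) K) (r : ℕ) :
    (twistedProd σ M r).det = ∏ i ∈ Finset.range r, σ^[i] M.det := by
  induction r with
  | zero => simp [twistedProd]
  | succ r ih =>
    rw [twistedProd, Matrix.det_mul, Finset.prod_range_succ', ← RingHom.mapMatrix_apply,
      ← RingHom.map_det, ih, map_prod]
    simp only [Function.iterate_succ_apply', Function.iterate_zero, id_eq]

theorem trace_twistedProd_fixed (σ : K →+* K) {M : Matrix (Fin 2) (Fin 2) K} {m : ℕ}
    (hM : M.map (σ^[m]) = M) (hdet : M.det ≠ 0) :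
    σ (twistedProd σ M m).trace = (twistedProd σ M m).trace := by
  have h : (twistedProd σ M m).map σ * M = M * twistedProd σ M m := by
    rw [← twistedProd, twistedProd_succ', hM]
  have hu : IsUnit M.det := hdet.isUnit
  have h' : (twistedProd σ M m).map σ = M * twistedProd σ M m * M⁻¹ := by
    rw [← h, Matrix.mul_assoc, Matrix.mul_nonsing_inv _ hu, Matrix.mul_one]
  have := AddMonoidHom.map_trace σ.toAddMonoidHom (twistedProd σ M m)
  change σ _ = ((twistedProd σ M m).map σ).trace at this
  rw [this, h', Matrix.trace_mul_cycle, Matrix.nonsing_inv_mul _ hu, Matrix.one_mul]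

theorem twistedProd_mulVec (σ : K →+* K) {M : Matrix (Fin 2) (Fin 2) K} {v : Fin 2 → K} {c : K}
    (h : M.mulVec v = c • (σ ∘ v)) (r : ℕ) :
    (twistedProd σ M r).mulVec v = (∏ i ∈ Finset.range r, σ^[i] c) • (σ^[r] ∘ v) := by
  induction r with
  | zero => simp [twistedProd]
  | succ r ih =>
    have key : ((twistedProd σ M r).map σ).mulVec (σ ∘ v) =
        σ ∘ (twistedProd σ M r).mulVec v := 
      funext fun i => (RingHom.map_mulVec σ _ _ i).symm
    rw [twistedProd, ← Matrix.mulVec_mulVec, h, Matrix.mulVec_smul, key, ih,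
      Finset.prod_range_succ']
    ext i
    simp only [Function.comp_apply, Pi.smul_apply, smul_eq_mul, map_mul, map_prod,
      Function.iterate_succ_apply', Function.iterate_zero, id_eq]
    ring

theorem eigenvalue_fin_two_quadratic {N : Matrix (Fin 2) (Fin 2) K} {v : Fin 2 → K} {l : K}
    (hv : v 1 ≠ 0) (h : N.mulVec v = l • v) : l ^ 2 - N.trace * l + N.det = 0 := by
  have h0 := congrFun h 0
  have h1 := congrFun h 1
  simp [Matrix.mulVec, dotProduct, Fin.sum_univ_two] at h0 h1
  rw [Matrix.trace_fin_two, Matrix.det_fin_two]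
  apply mul_left_cancel₀ hv
  linear_combination -N 1 0 * h0 - (l - N 0 0) * h1

theorem exists_eigenvector_fin_two (L : Subfield K) {N : Matrix (Fin 2) (Fin 2) K} {l : K}
    (hN : ∀ i j, N i j ∈ L) (hl : l ∈ L) (h : l ^ 2 - N.trace * l + N.det = 0) :
    ∃ v : Fin 2 → K, v ≠ 0 ∧ (∀ i, v i ∈ L) ∧ N.mulVec v = l • v := by
  rw [Matrix.trace_fin_two, Matrix.det_fin_two] at h
  by_cases h1 : N 0 1 = 0 ∧ l - N 0 0 = 0
  · by_cases h2 : l - N 1 1 = 0 ∧ N 1 0 = 0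
    · refine ⟨![1, 0], fun h => by simpa using congrFun h 0, ?_, ?_⟩
      · intro i; fin_cases i
        · exact L.one_mem
        · exact L.zero_mem
      · ext i; fin_cases i
        · simp [Matrix.mulVec, dotProduct]; linear_combination - h1.2
        · simp [Matrix.mulVec, dotProduct, h2.2]
    · refine ⟨![l - N 1 1, N 1 0], fun h => h2 ⟨congrFun h 0, congrFun h 1⟩, ?_, ?_⟩
      · intro i; fin_cases i
        · exact L.sub_mem hl (hN _ _)
        · exact hN _ _
      · ext i; fin_cases i
        · simp [Matrix.mulVec, dotProduct, Fin.sum_univ_two]; linear_combination -h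
        · simp [Matrix.mulVec, dotProduct, Fin.sum_univ_two]; ring
  · refine ⟨![N 0 1, l - N 0 0], fun h => h1 ⟨congrFun h 0, congrFun h 1⟩, ?_, ?_⟩
    · intro i; fin_cases i
      · exact hN _ _
      · exact L.sub_mem hl (hN _ _)
    · ext i; fin_cases i
      · simp [Matrix.mulVec, dotProduct, Fin.sum_univ_two]; ring
      · simp [Matrix.mulVec, dotProduct, Fin.sum_univ_two]; linear_combination -h

theorem twistedProd_mem (σ : K →+* K) (L : Subfield K) (hσ : ∀ x ∈ L, σ x ∈ L)
    {M : Matrix (Fin 2) (Fin 2) K} (hM : ∀ i j, M i j ∈ L) (r : ℕ) :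
    ∀ i j, twistedProd σ M r i j ∈ L := by
  induction r with
  | zero =>
    intro i j
    rw [twistedProd, Matrix.one_apply]
    split_ifs
    exacts [L.one_mem, L.zero_mem]
  | succ r ih =>
    intro i j
    rw [twistedProd, Matrix.mul_apply]
    exact L.sum_mem fun l _ => L.mul_mem (hσ _ (ih _ _)) (hM _ _)

/-- A vector form of Hilbert 90 for the `σ`-semilinear map `v ↦ c M⁻¹ σ(v)`. -/
theorem exists_fixed_of_eigenvector (σ : K →+* K) (L : Subfield K) (hσ : ∀ x ∈ L, σ x ∈ L) {m : ℕ}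
    (hm : ∀ x ∈ L, σ^[m] x = x)
    (hind : ∀ c : ℕ → K, c 0 ≠ 0 → ∃ t ∈ L, ∑ i ∈ Finset.range m, σ^[i] t * c i ≠ 0)
    {M : Matrix (Fin 2) (Fin 2) K} (hM : ∀ i j, M i j ∈ L) (hdet : M.det ≠ 0)
    {c : K} (hc : c ∈ L) {v : Fin 2 → K} (hv : v ≠ 0) (hvL : ∀ i, v i ∈ L)
    (hN : (twistedProd σ M m).mulVec v = (∏ i ∈ Finset.range m, σ^[i] c) • v) :
    ∃ w : Fin 2 → K, w ≠ 0 ∧ (∀ i, w i ∈ L) ∧ M.mulVec w = c • (σ ∘ w) := by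
  have hu : IsUnit M.det := hdet.isUnit
  have hinv : ∀ i j, M⁻¹ i j ∈ L := by
    intro i j
    have h : M⁻¹ = (M.det)⁻¹ • !![M 1 1, -M 0 1; -M 1 0, M 0 0] := by
      rw [Matrix.inv_def, Matrix.adjugate_fin_two, Ring.inverse_eq_inv']
    have hd : M.det ∈ L := by
      rw [Matrix.det_fin_two]
      exact L.sub_mem (L.mul_mem (hM _ _) (hM _ _)) (L.mul_mem (hM _ _) (hM _ _))
    rw [h]
    fin_cases i <;> fin_cases j <;>
      simp only [Matrix.smul_apply, smul_eq_mul] <;> refine L.mul_mem (L.inv_mem hd) ?_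
    exacts [hM _ _, L.neg_mem (hM _ _), L.neg_mem (hM _ _), hM _ _]
  set Ψ : (Fin 2 → K) → (Fin 2 → K) := fun w => c • M⁻¹.mulVec (σ ∘ w) with hΨ
  have hΨL : ∀ i j, Ψ^[i] v j ∈ L := by
    intro i
    induction i with
    | zero => exact hvL
    | succ i ih =>
      intro j
      rw [Function.iterate_succ_apply']
      refine L.mul_mem hc ?_
      rw [Matrix.mulVec, dotProduct]
      exact L.sum_mem fun l _ => L.mul_mem (hinv _ _) (hσ _ (ih _))
  have hMΨ : ∀ w, M.mulVec (Ψ w) = c • (σ ∘ w) := by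
    intro w
    rw [hΨ, Matrix.mulVec_smul, Matrix.mulVec_mulVec, Matrix.mul_nonsing_inv _ hu,
      Matrix.one_mulVec]
  have hprod : ∀ i, (twistedProd σ M i).mulVec (Ψ^[i] v) =
      (∏ j ∈ Finset.range i, σ^[j] c) • (σ^[i] ∘ v) := by
    intro i
    induction i with
    | zero => simp [twistedProd]
    | succ i ih =>
      have key : ((twistedProd σ M i).map σ).mulVec (σ ∘ Ψ^[i] v) =
          σ ∘ (twistedProd σ M i).mulVec (Ψ^[i] v) := 
        funext fun i => (RingHom.map_mulVec σ _ _ i).symm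
      rw [Function.iterate_succ_apply', twistedProd, ← Matrix.mulVec_mulVec, hMΨ,
        Matrix.mulVec_smul, key, ih, Finset.prod_range_succ']
      ext i
      simp only [Function.comp_apply, Pi.smul_apply, smul_eq_mul, map_mul, map_prod,
        Function.iterate_succ_apply', Function.iterate_zero, id_eq]
      ring
  have hcycle : Ψ^[m] v = v := by
    have h := hprod m
    have hvm : σ^[m] ∘ v = v := funext fun i => hm _ (hvL i)
    rw [hvm, ← hN] at h
    refine Matrix.mulVec_injective_of_isUnit ?_ h
    rw [Matrix.isUnit_iff_isUnit_det, isUnit_iff_ne_zero, det_twistedProd]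
    refine Finset.prod_ne_zero_iff.2 fun i _ => ?_
    rw [← RingHom.coe_pow]
    exact (_root_.map_ne_zero _).2 hdet
  obtain ⟨j, hj⟩ := Function.ne_iff.1 hv
  obtain ⟨t, ht, hsum⟩ := hind (fun i => Ψ^[i] v j) hj
  refine ⟨∑ i ∈ Finset.range m, σ^[i] t • Ψ^[i] v, fun h => hsum ?_, fun l => ?_, ?_⟩
  · simpa using congrFun h j
  · rw [Finset.sum_apply]
    refine L.sum_mem fun i _ => L.mul_mem ?_ (hΨL _ _)
    clear hsum
    induction i with
    | zero => exact ht
    | succ i ih => rw [Function.iterate_succ_apply']; exact hσ _ (ih (by simp_all; omega))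
  · have hshift : ∑ i ∈ Finset.range m, σ^[i] t • Ψ^[i] v =
        ∑ i ∈ Finset.range m, σ^[i + 1] t • Ψ^[i + 1] v := by
      have h1 := Finset.sum_range_succ (fun i => σ^[i] t • Ψ^[i] v) m
      rw [Finset.sum_range_succ'] at h1
      simp only [hm t ht, hcycle, Function.iterate_zero, id_eq] at h1
      exact (add_right_cancel h1).symm
    nth_rw 1 [hshift]
    rw [Matrix.mulVec_sum]
    simp only [Function.iterate_succ_apply', Matrix.mulVec_smul, hMΨ]
    ext l
    simp [Finset.mul_sum]
    refine Finset.sum_congr rfl fun i _ => by ring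

end TwistedProduct

section CharTwo

variable {K : Type*} [Field K]

theorem pow_two_pow_mul_eq {x : K} {d : ℕ} (h : x ^ 2 ^ d = x) (j : ℕ) : x ^ 2 ^ (d * j) = x := by
  induction j with
  | zero => simp
  | succ j ih => rw [Nat.mul_succ, pow_add, pow_mul, ih, h]

theorem prod_pow_frobenius_reindex {x : K} {n k : ℕ} (hn : 0 < n) (hx : x ^ 2 ^ n = x) :
    ∏ i ∈ Finset.range (n / n.gcd k), x ^ 2 ^ (k * i) =
      ∏ i ∈ Finset.range (n / n.gcd k), x ^ 2 ^ (n.gcd k * i) := by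
  set d := n.gcd k with hd
  have hd0 : 0 < d := Nat.gcd_pos_of_pos_left _ hn
  obtain ⟨k', hk'⟩ : d ∣ k := Nat.gcd_dvd_right n k
  obtain ⟨m, hm⟩ : d ∣ n := Nat.gcd_dvd_left n k
  have hm' : n / d = m := by rw [hm, Nat.mul_div_cancel_left _ hd0]
  have hk'' : k / d = k' := by rw [hk', Nat.mul_div_cancel_left _ hd0]
  have hm0 : 0 < m := Nat.pos_of_mul_pos_left (hm ▸ hn)
  have hcop : Nat.Coprime m k' := by
    rw [← hm', ← hk'']
    exact Nat.coprime_div_gcd_div_gcd hd0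
  rw [hm']
  have hmaps : ∀ i ∈ Finset.range m, k' * i % m ∈ Finset.range m := fun i _ =>
    Finset.mem_range.2 (Nat.mod_lt _ hm0)
  have hinj : Set.InjOn (fun i => k' * i % m) (Finset.range m : Set ℕ) := by
    intro i hi j hj hij
    have h : i ≡ j [MOD m] := Nat.ModEq.cancel_left_of_coprime hcop hij
    simp only [Finset.coe_range, Set.mem_Iio] at hi hj
    rwa [Nat.ModEq, Nat.mod_eq_of_lt hi, Nat.mod_eq_of_lt hj] at h
  refine Finset.prod_nbij (fun i => k' * i % m) hmaps hinj
    (Finset.surjOn_of_injOn_of_card_le _ hmaps hinj le_rfl) fun i _ => ?_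
  have hexp : k * i = n * (k' * i / m) + d * (k' * i % m) := by
    have := Nat.div_add_mod (k' * i) m
    calc k * i = d * (k' * i) := by rw [hk', mul_assoc]
      _ = d * (m * (k' * i / m) + k' * i % m) := by rw [this]
      _ = _ := by rw [hm]; ring
  rw [hexp, pow_add, pow_mul, pow_two_pow_mul_eq hx]

theorem prod_pow_frobenius_fixed {x : K} {d m : ℕ} (hx : x ^ 2 ^ (d * m) = x) :
    (∏ i ∈ Finset.range m, x ^ 2 ^ (d * i)) ^ 2 ^ d = ∏ i ∈ Finset.range m, x ^ 2 ^ (d * i) := by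
  rw [← Finset.prod_pow]
  by_cases hx0 : x = 0
  · subst hx0
    simp
  · have h1 := Finset.prod_range_succ (fun i => x ^ 2 ^ (d * i)) m
    rw [Finset.prod_range_succ'] at h1
    simp only [hx, mul_zero, pow_zero, pow_one] at h1
    rw [← mul_right_cancel₀ hx0 h1]
    exact Finset.prod_congr rfl fun i _ => by rw [← pow_mul, ← pow_add]; rfl

theorem exists_prod_pow_frobenius_eq [IsAlgClosed K] {l : K} (hl0 : l ≠ 0) {d m : ℕ} (hm : 0 < m)
    (hl : l ^ 2 ^ d = l) :
    ∃ c : K, c ^ 2 ^ (d * m) = c ∧ ∏ i ∈ Finset.range m, c ^ 2 ^ (d * i) = l := by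
  have hs : 0 < ∑ i ∈ Finset.range m, 2 ^ (d * i) :=
    Finset.sum_pos (fun i _ => by positivity) ⟨0, Finset.mem_range.2 hm⟩
  obtain ⟨c, hc⟩ := IsAlgClosed.exists_pow_nat_eq l hs
  have hc0 : c ≠ 0 := by
    rintro rfl
    exact hl0 (by rw [← hc, zero_pow hs.ne'])
  have hprod : ∏ i ∈ Finset.range m, c ^ 2 ^ (d * i) = l := by
    rw [Finset.prod_pow_eq_pow_sum, hc]
  refine ⟨c, ?_, hprod⟩
  have h1 := Finset.prod_range_succ (fun i => c ^ 2 ^ (d * i)) m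
  rw [Finset.prod_range_succ', hprod] at h1
  have h2 : ∏ i ∈ Finset.range m, c ^ 2 ^ (d * (i + 1)) = l := by
    rw [← hl, ← hprod, ← Finset.prod_pow]
    exact Finset.prod_congr rfl fun i _ => by rw [← pow_mul, ← pow_add]; rfl
  rw [h2] at h1
  simpa using (mul_left_cancel₀ hl0 h1).symm

variable [CharP K 2]

theorem sum_artinSchreier_pow (u : K) (d : ℕ) :
    ∑ i ∈ Finset.range d, (u ^ 2 + u) ^ 2 ^ i = u ^ 2 ^ d + u := by
  induction d with
  | zero => simp [CharTwo.add_self_eq_zero]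
  | succ d ih =>
    rw [Finset.sum_range_succ, ih, add_pow_char_pow, ← pow_mul, ← pow_succ']
    linear_combination CharTwo.add_self_eq_zero (u ^ 2 ^ d)

theorem pow_two_pow_gcd_eq {x : K} {n k : ℕ} (hn : x ^ 2 ^ n = x) (hk : x ^ 2 ^ k = x) :
    x ^ 2 ^ Nat.gcd n k = x := by
  have h (j : ℕ) (hj : x ^ 2 ^ j = x) : Function.IsPeriodicPt (frobenius K 2) j x := by
    rw [Function.IsPeriodicPt, Function.IsFixedPt, iterate_frobenius, hj]
  have := (h n hn).gcd (h k hk)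
  rwa [Function.IsPeriodicPt, Function.IsFixedPt, iterate_frobenius] at this

theorem pow_two_pow_injective (j : ℕ) : Function.Injective fun x : K => x ^ 2 ^ j :=
  (iterateFrobenius K 2 j).injective

theorem sum_trace_eq_zero_of_root {T N l : K} {d : ℕ} (hT : T ≠ 0) (hTd : T ^ 2 ^ d = T)
    (hld : l ^ 2 ^ d = l) (h : l ^ 2 - T * l + N = 0) :
    ∑ i ∈ Finset.range d, (N / T ^ 2) ^ 2 ^ i = 0 := by
  have : N / T ^ 2 = (l / T) ^ 2 + l / T := by
    field_simp
    linear_combination h - CharTwo.add_self_eq_zero (l ^ 2)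
  rw [this, sum_artinSchreier_pow, div_pow, hTd, hld, CharTwo.add_self_eq_zero]

theorem exists_root_of_sum_trace_eq_zero [IsAlgClosed K] {T N : K} {d : ℕ} (hTd : T ^ 2 ^ d = T)
    (hNd : N ^ 2 ^ d = N)
    (h : T ≠ 0 → ∑ i ∈ Finset.range d, (N / T ^ 2) ^ 2 ^ i = 0) :
    ∃ l : K, l ^ 2 ^ d = l ∧ l ^ 2 - T * l + N = 0 := by
  by_cases hT : T = 0
  · obtain ⟨l, hl⟩ := IsAlgClosed.exists_pow_nat_eq N two_pos
    refine ⟨l, pow_two_pow_injective 1 ?_, ?_⟩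
    · change (l ^ 2 ^ d) ^ 2 ^ 1 = l ^ 2 ^ 1
      rw [pow_one, pow_right_comm, hl, hNd]
    · rw [hT, hl]
      linear_combination CharTwo.add_self_eq_zero N
  · have hdeg : (X ^ 2 + X - C (N / T ^ 2) : K[X]).degree ≠ 0 := by
      have : (X ^ 2 + X - C (N / T ^ 2) : K[X]).degree = 2 := by compute_degree!
      rw [this]; decide
    obtain ⟨u, hu⟩ := IsAlgClosed.exists_root _ hdeg
    have hu' : N / T ^ 2 = u ^ 2 + u := by
      simp [IsRoot] at hu
      linear_combination -hu
    have hsum := h hT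
    rw [hu', sum_artinSchreier_pow] at hsum
    refine ⟨T * u, ?_, ?_⟩
    · rw [mul_pow, hTd, CharTwo.add_eq_zero.1 hsum]
    · have : N = T ^ 2 * (u ^ 2 + u) := by rw [← hu']; field_simp
      rw [this]
      linear_combination CharTwo.add_self_eq_zero (T ^ 2 * u ^ 2)

theorem exists_sum_pow_frobenius_ne_zero [IsAlgClosed K] {n k : ℕ} (hn : 0 < n)
    (c : ℕ → K) (hc : c 0 ≠ 0) :
    ∃ t : K, t ^ 2 ^ n = t ∧
      ∑ i ∈ Finset.range (n / n.gcd k), t ^ 2 ^ (k * i) * c i ≠ 0 := by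
  have hm0 : 0 < n / n.gcd k := Nat.div_gcd_pos_of_pos_left k hn
  have h2n : 1 < 2 ^ n := Nat.one_lt_two_pow hn.ne'
  have : NeZero (((2 ^ n - 1 : ℕ)) : K) := ⟨by
    rw [Nat.cast_sub h2n.le, Nat.cast_pow, Nat.cast_ofNat, CharTwo.two_eq_zero, zero_pow hn.ne']
    simp⟩
  obtain ⟨ζ, hζ⟩ := HasEnoughRootsOfUnity.exists_primitiveRoot K (2 ^ n - 1)
  have hζn : ζ ^ 2 ^ n = ζ := by
    rw [← Nat.sub_add_cancel h2n.le, pow_succ, hζ.pow_eq_one, one_mul]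
  have hζ0 : ζ ≠ 0 := hζ.ne_zero (Nat.sub_pos_of_lt h2n).ne'
  have hlt : ∀ i j, i < j → j < n / n.gcd k → ζ ^ 2 ^ (k * i) ≠ ζ ^ 2 ^ (k * j) := by
    intro i j hij hj heq
    obtain ⟨r, rfl⟩ := Nat.exists_eq_add_of_lt hij
    have h1 : ζ ^ 2 ^ (k * (r + 1)) = ζ := by
      refine (pow_two_pow_injective (k * i) ?_).symm
      change ζ ^ 2 ^ (k * i) = (ζ ^ 2 ^ (k * (r + 1))) ^ 2 ^ (k * i)
      rw [heq, ← pow_mul, ← pow_add]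
      congr 2
      ring
    have h2 := pow_two_pow_gcd_eq hζn h1
    set e := n.gcd (k * (r + 1)) with he
    have he0 : 0 < e := Nat.gcd_pos_of_pos_left _ hn
    have h2e : 1 < 2 ^ e := Nat.one_lt_two_pow he0.ne'
    have h3 : ζ ^ (2 ^ e - 1) = 1 := by
      rw [← Nat.sub_add_cancel h2e.le, pow_succ] at h2
      exact mul_right_cancel₀ hζ0 (by rw [h2, one_mul])
    have h4 := Nat.le_of_dvd (Nat.sub_pos_of_lt h2e) (hζ.dvd_of_pow_eq_one _ h3)
    have h5 : n ≤ e := (Nat.pow_le_pow_iff_right one_lt_two).1 (by omega)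
    have h6 : n ∣ k * (r + 1) := by
      have : e = n := le_antisymm (Nat.le_of_dvd hn (Nat.gcd_dvd_left _ _)) h5
      rw [← this]
      exact Nat.gcd_dvd_right _ _
    have h7 : n / n.gcd k ∣ r + 1 := by
      have hd0 : 0 < n.gcd k := Nat.gcd_pos_of_pos_left _ hn
      refine (Nat.coprime_div_gcd_div_gcd hd0).dvd_of_dvd_mul_left  ?_
      rw [← Nat.mul_dvd_mul_iff_left hd0, ← mul_assoc,
        Nat.mul_div_cancel' (Nat.gcd_dvd_left n k), Nat.mul_div_cancel' (Nat.gcd_dvd_right n k)]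
      exact h6
    have := Nat.le_of_dvd (Nat.succ_pos _) h7
    omega
  by_contra! hcon
  refine hc (congrFun (Matrix.eq_zero_of_forall_pow_sum_mul_pow_eq_zero
    (f := fun i : Fin (n / n.gcd k) => ζ ^ 2 ^ (k * (i : ℕ)))
    (v := fun i : Fin (n / n.gcd k) => c i) ?_ ?_) ⟨0, hm0⟩)
  · intro i j hij
    rcases lt_trichotomy i j with h | h | h
    · exact absurd hij (hlt _ _ h j.2)
    · exact h
    · exact absurd hij.symm (hlt _ _ h i.2)
  · intro j
    rw [← hcon (ζ ^ (j : ℕ)) (by rw [pow_right_comm, hζn]), ← Fin.sum_univ_eq_sum_range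
      (fun i => (ζ ^ (j : ℕ)) ^ 2 ^ (k * i) * c i)]
    exact Finset.sum_congr rfl fun i _ => by rw [pow_right_comm]; ring

end CharTwo

section Companion

variable {K : Type} [Field K]

theorem companion_entry_mem (L : Subfield K) {a : K} (ha : a ∈ L) (i j : Fin 2) :
    (!![1, a; 1, 0] : Matrix (Fin 2) (Fin 2) K) i j ∈ L := by
  fin_cases i <;> fin_cases j
  exacts [L.one_mem, ha, L.one_mem, L.zero_mem]

variable [CharP K 2]

theorem A_eval_succ_succ (k : ℕ) (a : K) (r : ℕ) :
    (A (2 ^ k) K (r + 2)).eval a =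
      (A (2 ^ k) K (r + 1)).eval a ^ 2 ^ k +
        a ^ 2 ^ k * ((A (2 ^ k) K r).eval a ^ 2 ^ k) ^ 2 ^ k := by
  cases r with
  | zero => simp [A, CharTwo.neg_eq]
  | succ r => simp [A, CharTwo.neg_eq, CharTwo.sub_eq_add, ← pow_mul, sq]

theorem twistedProd_companion (k : ℕ) (a : K) (r : ℕ) :
    twistedProd (iterateFrobenius K 2 k) !![1, a; 1, 0] (r + 1) =
      !![(A (2 ^ k) K (r + 2)).eval a, a * (A (2 ^ k) K (r + 1)).eval a ^ 2 ^ k;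
        (A (2 ^ k) K (r + 1)).eval a, a * (A (2 ^ k) K r).eval a ^ 2 ^ k] := by
  induction r with
  | zero =>
    ext i j
    fin_cases i <;> fin_cases j <;> simp [twistedProd, A, CharTwo.neg_eq]
  | succ r ih =>
    rw [twistedProd, ih, A_eval_succ_succ k a (r + 1), A_eval_succ_succ k a r]
    ext i j
    fin_cases i <;> fin_cases j <;>
      simp [Matrix.mul_apply, Fin.sum_univ_two, iterateFrobenius_def, mul_pow] <;> ring

theorem trace_twistedProd_companion (k : ℕ) (a : K) {m : ℕ} (hm : 0 < m) :
    (twistedProd (iterateFrobenius K 2 k) !![1, a; 1, 0] m).trace =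
      -(A (2 ^ k) K (m + 1)).eval a - a * (A (2 ^ k) K (m - 1)).eval a ^ 2 ^ k := by
  obtain ⟨r, rfl⟩ := Nat.exists_eq_succ_of_ne_zero hm.ne'
  rw [Nat.succ_eq_add_one, twistedProd_companion, Matrix.trace_fin_two, CharTwo.neg_eq,
    CharTwo.sub_eq_add]
  rfl

theorem iterate_iterateFrobenius_apply (k i : ℕ) (x : K) :
    (iterateFrobenius K 2 k)^[i] x = x ^ 2 ^ (k * i) := by
  induction i with
  | zero => simp
  | succ i ih =>
    rw [Function.iterate_succ_apply', ih, iterateFrobenius_def, ← pow_mul, ← pow_add,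
      Nat.mul_succ]

theorem root_of_companion_mulVec {k : ℕ} {a c : K} (hc : c ≠ 0) {w : Fin 2 → K}
    (hw : w ≠ 0)
    (h : Matrix.mulVec !![1, a; 1, 0] w = c • (iterateFrobenius K 2 k ∘ w)) :
    (w 0 / w 1) ^ (2 ^ k + 1) + w 0 / w 1 + a = 0 := by
  have h0 : w 0 + a * w 1 = c * w 0 ^ 2 ^ k := by
    simpa [Matrix.mulVec, dotProduct, iterateFrobenius_def] using congrFun h 0
  have h1 : w 0 = c * w 1 ^ 2 ^ k := by
    simpa [Matrix.mulVec, dotProduct, iterateFrobenius_def] using congrFun h 1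
  have hw1 : w 1 ≠ 0 := by
    intro hz
    refine hw (funext fun i => ?_)
    fin_cases i
    · simpa [hz] using h1
    · exact hz
  have key : (w 0 / w 1) ^ (2 ^ k + 1) = w 0 / w 1 + a := by
    have hw1k : w 1 ^ 2 ^ k ≠ 0 := pow_ne_zero _ hw1
    rw [pow_succ, div_pow]
    field_simp
    refine mul_left_cancel₀ hc ?_
    linear_combination (w 0 + a * w 1) * h1 - w 0 * h0
  rw [key, add_assoc]
  exact CharTwo.add_self_eq_zero _

/-- The field of `2 ^ n` elements inside `K`. -/
def fixedSubfield (K : Type) [Field K] [CharP K 2] (n : ℕ) : Subfield K :=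
  (iterateFrobenius K 2 n).eqLocusField (RingHom.id K)

theorem mem_fixedSubfield {n : ℕ} {x : K} : x ∈ fixedSubfield K n ↔ x ^ 2 ^ n = x := Iff.rfl

theorem iterateFrobenius_mem_fixedSubfield {n : ℕ} (k : ℕ) {x : K} (hx : x ∈ fixedSubfield K n) :
    iterateFrobenius K 2 k x ∈ fixedSubfield K n :=
  pow_mem hx _

theorem iterate_iterateFrobenius_fixed {n k : ℕ} {x : K} (hx : x ^ 2 ^ n = x) :
    (iterateFrobenius K 2 k)^[n / n.gcd k] x = x := by
  rw [iterate_iterateFrobenius_apply, ← Nat.mul_div_assoc _ (Nat.gcd_dvd_left n k), mul_comm,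
    Nat.mul_div_assoc _ (Nat.gcd_dvd_right n k), pow_two_pow_mul_eq hx]

theorem exists_root_iff_exists_eigenvalue [IsAlgClosed K] {n k : ℕ} (hn : 0 < n) {a : K}
    (han : a ^ 2 ^ n = a) (ha : a ≠ 0) {T N : K}
    (hT : T = (twistedProd (iterateFrobenius K 2 k) !![1, a; 1, 0] (n / n.gcd k)).trace)
    (hN : N = (twistedProd (iterateFrobenius K 2 k) !![1, a; 1, 0] (n / n.gcd k)).det)
    (hN0 : N ≠ 0) :
    (∃ x : K, x ^ 2 ^ n = x ∧ x ^ (2 ^ k + 1) + x + a = 0) ↔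
      ∃ l : K, l ^ 2 ^ n.gcd k = l ∧ l ^ 2 - T * l + N = 0 := by
  set m := n / n.gcd k with hm
  have hm0 : 0 < m := Nat.div_gcd_pos_of_pos_left k hn
  have hdm : n.gcd k * m = n := Nat.mul_div_cancel' (Nat.gcd_dvd_left n k)
  have hprod : ∀ x : K, x ^ 2 ^ n = x →
      ∏ i ∈ Finset.range m, (iterateFrobenius K 2 k)^[i] x =
        ∏ i ∈ Finset.range m, x ^ 2 ^ (n.gcd k * i) := fun x hx => by
    simp only [iterate_iterateFrobenius_apply]
    exact prod_pow_frobenius_reindex hn hx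
  constructor
  · rintro ⟨x, hx, hroot⟩
    have hMx : Matrix.mulVec !![1, a; 1, 0] ![x, 1] =
        x • (iterateFrobenius K 2 k ∘ ![x, 1]) := by
      ext i
      fin_cases i
      · simp [iterateFrobenius_def]
        rw [pow_succ] at hroot
        linear_combination hroot - CharTwo.add_self_eq_zero (x ^ 2 ^ k * x)
      · simp
    have h := twistedProd_mulVec _ hMx m
    have hfix : (iterateFrobenius K 2 k)^[m] ∘ ![x, 1] = ![x, 1] := by
      ext i
      fin_cases i
      · exact iterate_iterateFrobenius_fixed hx
      · exact iterate_iterateFrobenius_fixed (one_pow _)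
    rw [hfix, hprod x hx] at h
    refine ⟨_, prod_pow_frobenius_fixed (by rw [hdm, hx]), ?_⟩
    rw [hT, hN]
    exact eigenvalue_fin_two_quadratic (by simp) h
  · rintro ⟨l, hl, hquad⟩
    have hl0 : l ≠ 0 := by
      rintro rfl
      exact hN0 (by simpa using hquad)
    obtain ⟨c, hc, hcl⟩ := exists_prod_pow_frobenius_eq hl0 hm0 hl
    rw [hdm] at hc
    have hc0 : c ≠ 0 := by
      rintro rfl
      refine hl0 ?_
      rw [← hcl]
      exact Finset.prod_eq_zero (Finset.mem_range.2 hm0) (by simp)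
    have hlL : l ∈ fixedSubfield K n := by
      rw [mem_fixedSubfield, ← hdm, pow_two_pow_mul_eq hl]
    have hσL : ∀ x ∈ fixedSubfield K n, iterateFrobenius K 2 k x ∈ fixedSubfield K n :=
      fun x hx => iterateFrobenius_mem_fixedSubfield k hx
    have hML := companion_entry_mem (fixedSubfield K n) han
    rw [hT, hN] at hquad
    obtain ⟨v, hv0, hvL, hv⟩ := exists_eigenvector_fin_two _
      (twistedProd_mem _ _ hσL hML m) hlL hquad
    obtain ⟨w, hw0, hwL, hw⟩ := exists_fixed_of_eigenvector (iterateFrobenius K 2 k) _ hσL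
      (fun x hx => iterate_iterateFrobenius_fixed hx)
      (fun f hf => by
        simp only [iterate_iterateFrobenius_apply]
        exact exists_sum_pow_frobenius_ne_zero hn f hf)
      hML (by simpa using ha) hc hv0 hvL (by rw [hv, hprod c hc, hcl])
    exact ⟨w 0 / w 1, div_mem (hwL 0) (hwL 1), root_of_companion_mulVec hc0 hw0 hw⟩

end Companion

/-- `p = 2`. For nonzero `a ∈ GF(Q)`, with
`H = Tr_{GF(2^d)/GF(2)}(N_{GF(Q)/GF(2^d)}(a)/G(a)²)` (defined when `G(a) ≠ 0`):
`P_a(X) = X^{q+1} + X + a` has no zeros in `GF(Q)` iff `G(a) ≠ 0` and `H ≠ 0`.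
Here `F(a) = A_m(a)`, `G(a) = -A_{m+1}(a) - a·A_{m-1}(a)^q`, `q = 2^k`, `Q = 2^n`,
`d = gcd(n,k)`, `m = n/d`; the trace is a sum of Frobenius powers and the norm the product
of conjugates, inside the algebraic closure of GF(2). -/
theorem statement_19 (k n d m q Q : ℕ) (hk : 0 < k) (hn : 0 < n)
    (hd : d = Nat.gcd n k) (hm : m = n / d) (hq : q = 2 ^ k) (hQ : Q = 2 ^ n)
    (a : Kbar 2) (haQ : a ^ Q = a) (ha0 : a ≠ 0)
    (Ga Nr H : Kbar 2)
    (hGa : Ga = -(A q (Kbar 2) (m + 1)).eval a - a * ((A q (Kbar 2) (m - 1)).eval a) ^ q)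
    (hNr : Nr = ∏ i ∈ Finset.range m, a ^ (2 ^ d) ^ i)
    (hH : Ga ≠ 0 → H = ∑ i ∈ Finset.range d, (Nr / Ga ^ 2) ^ 2 ^ i) :
    {x : Kbar 2 | x ^ Q = x ∧ x ^ (q + 1) + x + a = 0} = ∅ ↔ Ga ≠ 0 ∧ H ≠ 0 := by
  subst hd hm hq hQ
  set m := n / n.gcd k with hm
  have hm0 : 0 < m := Nat.div_gcd_pos_of_pos_left k hn
  have hdm : n.gcd k * m = n := Nat.mul_div_cancel' (Nat.gcd_dvd_left n k)
  simp only [← pow_mul] at hNr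
  have hdetM : (!![1, a; 1, 0] : Matrix (Fin 2) (Fin 2) (Kbar 2)).det = a := by
    rw [Matrix.det_fin_two_of, CharTwo.sub_eq_add]
    ring
  have hdet : Nr = (twistedProd (iterateFrobenius (Kbar 2) 2 k) !![1, a; 1, 0] m).det := by
    rw [det_twistedProd, hNr, hdetM]
    simp only [iterate_iterateFrobenius_apply]
    exact (prod_pow_frobenius_reindex hn haQ).symm
  rw [← trace_twistedProd_companion k a hm0] at hGa
  have hNr0 : Nr ≠ 0 := by
    rw [hNr]
    exact Finset.prod_ne_zero_iff.2 fun i _ => pow_ne_zero _ ha0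
  have hNrd : Nr ^ 2 ^ n.gcd k = Nr := by
    rw [hNr]
    exact prod_pow_frobenius_fixed (by rw [hdm, haQ])
  have hσM : (!![1, a; 1, 0] : Matrix (Fin 2) (Fin 2) (Kbar 2)).map
      ((iterateFrobenius (Kbar 2) 2 k)^[m]) = !![1, a; 1, 0] := by
    ext i j
    exact iterate_iterateFrobenius_fixed
      (companion_entry_mem (fixedSubfield (Kbar 2) n) haQ i j)
  have hGk : Ga ^ 2 ^ k = Ga := by
    rw [hGa]
    exact trace_twistedProd_fixed _ hσM (hdetM.symm ▸ ha0)
  have hGn : Ga ^ 2 ^ n = Ga := by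
    have hmem := twistedProd_mem (iterateFrobenius (Kbar 2) 2 k) (fixedSubfield (Kbar 2) n)
      (fun x hx => iterateFrobenius_mem_fixedSubfield k hx) (companion_entry_mem _ haQ) m
    rw [← mem_fixedSubfield, hGa, Matrix.trace_fin_two]
    exact add_mem (hmem 0 0) (hmem 1 1)
  have hGd := pow_two_pow_gcd_eq hGn hGk
  rw [Set.eq_empty_iff_forall_notMem, ← not_iff_not]
  simp only [Set.mem_ofPred_eq, not_forall, not_not]
  rw [exists_root_iff_exists_eigenvalue hn haQ ha0 hGa hdet hNr0]
  constructor
  · rintro ⟨l, hl, hquad⟩ ⟨hG0, hH0⟩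
    exact hH0 (by rw [hH hG0, sum_trace_eq_zero_of_root hG0 hGd hl hquad])
  · intro h
    refine exists_root_of_sum_trace_eq_zero hGd hNrd fun hG0 => ?_
    rw [← hH hG0]
    by_contra hH0
    exact h ⟨hG0, hH0⟩
end
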